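/- arXiv:math/0403226 — 2 statements merged into one kernel-verified Lean document; each statement's English description precedes it below -/
import Mathlib

section
/- Let q > 0 and let J be a zero-diagonal Jacobi operator with bounded real off-diagonal entries (j_n)_{n≥1} satisfying j_n = 1/2 + (q/n)·(1 + o(1)) as n → ∞. Then √(s−1)·N₊(s; J) → q·√2 as s ↘ 1; equivalently, N₊(s; J) ∼ q√2/√(s−1) as s ↘ 1. -/
/-- Action of the zero-diagonal Jacobi matrix with off-diagonal entries `(j_n)_{n≥1}`:
`(Jg)(n) = j_n·g(n-1) + j_{n+1}·g(n+1)`, with the convention `g(-1) := 0`. -/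
noncomputable def jacobiApply (j : ℕ → ℝ) (g : ℕ → ℂ) : ℕ → ℂ
  | 0 => (j 1 : ℂ) * g 1
  | (n + 1) => (j (n + 1) : ℂ) * g n + (j (n + 2) : ℂ) * g (n + 2)

/-- `Re⟪Jg, g⟫_{ℓ²}` as a series. -/
noncomputable def jacobiForm (j : ℕ → ℝ) (g : ℕ → ℂ) : ℝ :=
  ∑' n : ℕ, (jacobiApply j g n * (starRingEnd ℂ) (g n)).re

/-- `N₊(s; J)`: supremum of dimensions of finite-dimensional subspaces
`F ⊆ ℓ²(ℕ₀,ℂ)` on which `Re⟪Jg, g⟫ > s·‖g‖²` for every nonzero `g ∈ F`. -/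
noncomputable def Nplus (j : ℕ → ℝ) (s : ℝ) : ℕ∞ :=
  sSup {d : ℕ∞ | ∃ F : Submodule ℂ (lp (fun _ : ℕ => ℂ) 2),
    FiniteDimensional ℂ F ∧
    (∀ g ∈ F, g ≠ 0 → s * ‖g‖ ^ 2 < jacobiForm j (fun n => g n)) ∧
    d = (Module.finrank ℂ F : ℕ∞)}

section
open Polynomial Filter

/-- Polynomials `p_k` such that `r ^ n * p_k(n)`, with `t = r ^ 2`, solves the discrete Coulomb
problem on the half-line with coupling constant `k * (r⁻¹ - r)`. -/
noncomputable def coulombPoly (t : ℝ) : ℕ → ℝ[X]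
  | 0 => 1
  | k + 1 => C t * X * (coulombPoly t k).comp (X + 1) - (X - C (k : ℝ)) * coulombPoly t k

theorem coulombPoly_eval_succ (t : ℝ) (k : ℕ) (x : ℝ) :
    (coulombPoly t (k + 1)).eval x =
      t * x * (coulombPoly t k).eval (x + 1) - (x - k) * (coulombPoly t k).eval x := by
  simp [coulombPoly]

theorem coulombPoly_difference_equation (t : ℝ) (k : ℕ) (x : ℝ) :
    x * (t * (coulombPoly t k).eval (x + 1) + (coulombPoly t k).eval (x - 1)
      - (t + 1) * (coulombPoly t k).eval x) = -(k * (1 - t)) * (coulombPoly t k).eval x := by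
  induction k generalizing x with
  | zero => simp [coulombPoly]
  | succ k ih =>
    have h1 := ih x
    have h2 := ih (x + 1)
    simp only [coulombPoly_eval_succ, add_sub_cancel_right, sub_add_cancel] at *
    push_cast
    linear_combination x * t * h2 - (x - 1 - k) * h1

theorem natDegree_coulombPoly_le (t : ℝ) (k : ℕ) : (coulombPoly t k).natDegree ≤ k := by
  induction k with
  | zero => simp [coulombPoly]
  | succ k ih =>
    rw [coulombPoly]
    refine (natDegree_sub_le _ _).trans (max_le ?_ ?_)
    · refine natDegree_mul_le.trans ?_
      have h1 : (C t * X : ℝ[X]).natDegree ≤ 1 := (natDegree_C_mul_le t X).trans natDegree_X_le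
      have h2 : ((coulombPoly t k).comp (X + 1)).natDegree ≤ k := by
        refine natDegree_comp_le.trans ?_
        have : (X + 1 : ℝ[X]).natDegree = 1 := by simpa using natDegree_X_add_C (1 : ℝ)
        rw [this]; omega
      omega
    · refine natDegree_mul_le.trans ?_
      rw [natDegree_X_sub_C]; omega

theorem coulombPoly_succ_eval_zero (t : ℝ) (k : ℕ) : (coulombPoly t (k + 1)).eval 0 = 0 := by
  induction k with
  | zero => simp [coulombPoly]
  | succ k ih => rw [coulombPoly_eval_succ, ih]; ring

theorem coulombPoly_succ_eval_one_ne_zero {t : ℝ} (ht0 : t ≠ 0) (ht1 : t ≠ 1) (k : ℕ) :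
    (coulombPoly t (k + 1)).eval 1 ≠ 0 := by
  induction k with
  | zero => simpa [coulombPoly] using sub_ne_zero.2 ht1
  | succ k ih =>
    have h := coulombPoly_difference_equation t (k + 1) 1
    rw [sub_self, coulombPoly_succ_eval_zero] at h
    have : (coulombPoly t (k + 2)).eval 1 = t * (k + 2) * (coulombPoly t (k + 1)).eval 1 := by
      rw [coulombPoly_eval_succ]
      push_cast at h ⊢
      linear_combination h
    rw [this]
    have : (k : ℝ) + 2 ≠ 0 := by positivity
    exact mul_ne_zero (mul_ne_zero ht0 this) ih

/-- The solution of the discrete Coulomb problem attached to `coulombPoly`, indexed from `0`. -/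
noncomputable def coulombSol (r : ℝ) (k n : ℕ) : ℝ :=
  r ^ (n + 1) * (coulombPoly (r ^ 2) k).eval (n + 1 : ℝ)

theorem coulombSol_one {r : ℝ} (hr : r ≠ 0) (k : ℕ) :
    coulombSol r (k + 1) 1 =
      (r + r⁻¹ - (k + 1) * (r⁻¹ - r)) * coulombSol r (k + 1) 0 := by
  have h := coulombPoly_difference_equation (r ^ 2) (k + 1) 1
  rw [sub_self, coulombPoly_succ_eval_zero] at h
  simp only [coulombSol]
  push_cast at h ⊢
  rw [zero_add]
  field_simp
  linear_combination h

theorem coulombSol_add_two {r : ℝ} (hr : r ≠ 0) (k n : ℕ) :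
    coulombSol r k (n + 2) + coulombSol r k n =
      (r + r⁻¹ - k * (r⁻¹ - r) / (n + 2)) * coulombSol r k (n + 1) := by
  have h := coulombPoly_difference_equation (r ^ 2) k (n + 2)
  simp only [coulombSol]
  have e1 : (((n + 2 : ℕ) : ℝ) + 1) = n + 2 + 1 := by push_cast; ring
  have e2 : (((n + 1 : ℕ) : ℝ) + 1) = n + 2 := by push_cast; ring
  have e3 : (n : ℝ) + 2 - 1 = n + 1 := by ring
  rw [e1, e2]
  rw [e3] at h
  have : (n : ℝ) + 2 ≠ 0 := by positivity
  field_simp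
  linear_combination h * r ^ (n + 2)

theorem coulombSol_zero_ne_zero {r : ℝ} (h0 : 0 < r) (h1 : r < 1) (k : ℕ) :
    coulombSol r (k + 1) 0 ≠ 0 := by
  have : (coulombPoly (r ^ 2) (k + 1)).eval 1 ≠ 0 :=
    coulombPoly_succ_eval_one_ne_zero (by positivity) (by nlinarith) k
  simpa [coulombSol, h0.ne'] using this

theorem summable_abs_coulombSol {r : ℝ} (h0 : 0 < r) (h1 : r < 1) (k : ℕ) :
    Summable fun n => |coulombSol r k n| := by
  have key : Summable fun n : ℕ => r ^ n * (coulombPoly (r ^ 2) k).eval (n : ℝ) := by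
    simp only [eval_eq_sum_range, Finset.mul_sum]
    refine summable_sum fun i _ => ?_
    have := (summable_pow_mul_geometric_of_norm_lt_one (R := ℝ) i (r := r)
      (by rwa [Real.norm_of_nonneg h0.le])).mul_left ((coulombPoly (r ^ 2) k).coeff i)
    refine this.congr fun n => by ring
  have := ((summable_nat_add_iff 1).2 key).abs
  refine this.congr fun n => ?_
  simp [coulombSol]

theorem exists_finset_sign_changes {r : ℝ} (h0 : 0 < r) (h1 : r < 1) (k : ℕ) :
    ∃ T : Finset ℕ, T.card ≤ k + 1 ∧ ∀ n, coulombSol r (k + 1) n = 0 ∨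
      coulombSol r (k + 1) n * coulombSol r (k + 1) (n + 1) < 0 → n ∈ T := by
  classical
  set p := coulombPoly (r ^ 2) (k + 1) with hp
  have hp0 : p ≠ 0 := by
    intro h
    apply coulombSol_zero_ne_zero h0 h1 k
    simp [coulombSol, ← hp, h]
  refine ⟨p.roots.toFinset.image fun x => ⌊x⌋₊ - 1, ?_, ?_⟩
  · exact Finset.card_image_le.trans ((Multiset.toFinset_card_le _).trans
      ((card_roots' p).trans (natDegree_coulombPoly_le _ _)))
  · intro n hn
    suffices ∃ x : ℝ, p.eval x = 0 ∧ (n : ℝ) + 1 ≤ x ∧ x < n + 2 by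
      obtain ⟨x, hx, hx1, hx2⟩ := this
      refine Finset.mem_image.2 ⟨x, by simp [hp0, hx], ?_⟩
      have : ⌊x⌋₊ = n + 1 := by
        rw [Nat.floor_eq_iff (by linarith [(Nat.cast_nonneg n : (0 : ℝ) ≤ n)])]
        push_cast
        exact ⟨hx1, by linarith⟩
      rw [this]; rfl
    have hA : coulombSol r (k + 1) n = r ^ (n + 1) * p.eval (n + 1 : ℝ) := rfl
    have hB : coulombSol r (k + 1) (n + 1) = r ^ (n + 2) * p.eval (n + 2 : ℝ) := by
      have : ((n + 1 : ℕ) : ℝ) + 1 = n + 2 := by push_cast; ring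
      rw [coulombSol, this]
    rw [hA, hB] at hn
    rcases hn with hn | hn
    · refine ⟨n + 1, ?_, le_rfl, by linarith⟩
      simpa [h0.ne'] using hn
    · have hlt : p.eval (n + 1 : ℝ) * p.eval (n + 2 : ℝ) < 0 := by
        by_contra hcon
        push Not at hcon
        have : 0 ≤ r ^ (n + 1) * r ^ (n + 2) * (p.eval (n + 1 : ℝ) * p.eval (n + 2 : ℝ)) := by
          positivity
        linarith
      have hcont : ContinuousOn (fun x => p.eval x) (Set.Icc (n + 1 : ℝ) (n + 2)) :=
        p.continuous.continuousOn
      have hle : (n : ℝ) + 1 ≤ n + 2 := by linarith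
      have h0mem : ∃ x ∈ Set.Icc (n + 1 : ℝ) (n + 2), p.eval x = 0 := by
        rcases mul_neg_iff.1 hlt with ⟨ha, hb⟩ | ⟨ha, hb⟩
        · exact intermediate_value_Icc' hle hcont ⟨hb.le, ha.le⟩
        · exact intermediate_value_Icc hle hcont ⟨ha.le, hb.le⟩
      obtain ⟨x, ⟨hx1, hx2⟩, hx⟩ := h0mem
      refine ⟨x, hx, hx1, lt_of_le_of_ne hx2 ?_⟩
      rintro rfl
      rw [hx, mul_zero] at hlt
      exact lt_irrefl _ hlt

theorem lp_two_hasSum_norm_sq (g : lp (fun _ : ℕ => ℂ) 2) :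
    HasSum (fun n => ‖g n‖ ^ 2) (‖g‖ ^ 2) := by
  have := lp.hasSum_norm (p := 2) (by norm_num) g
  simpa using this

/-- The Jacobi form as a sum over edges. -/
theorem hasSum_jacobiForm {j : ℕ → ℝ} (hbd : ∃ M : ℝ, ∀ n, |j n| ≤ M) {g : ℕ → ℂ}
    (hg : Summable fun n => ‖g n‖ ^ 2) :
    HasSum (fun n => 2 * j (n + 1) * (g (n + 1) * (starRingEnd ℂ) (g n)).re)
      (jacobiForm j g) := by
  obtain ⟨M, hM⟩ := hbd
  have hs : Summable fun n => j (n + 1) * (g (n + 1) * (starRingEnd ℂ) (g n)).re := by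
    have hdom : Summable fun n => M * (‖g (n + 1)‖ ^ 2 + ‖g n‖ ^ 2) :=
      (((summable_nat_add_iff 1).2 hg).add hg).mul_left M
    refine hdom.of_norm_bounded fun n => ?_
    rw [Real.norm_eq_abs, abs_mul]
    have h1 : |(g (n + 1) * (starRingEnd ℂ) (g n)).re| ≤ ‖g (n + 1)‖ ^ 2 + ‖g n‖ ^ 2 := by
      refine (Complex.abs_re_le_norm _).trans ?_
      rw [norm_mul, RCLike.norm_conj]
      nlinarith [sq_nonneg (‖g (n + 1)‖ - ‖g n‖), sq_nonneg (‖g (n + 1)‖),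
        sq_nonneg (‖g n‖)]
    exact mul_le_mul (hM _) h1 (abs_nonneg _) ((abs_nonneg _).trans (hM 0))
  set R : ℕ → ℝ := fun n => j (n + 1) * (g (n + 1) * (starRingEnd ℂ) (g n)).re with hR
  obtain ⟨a, ha⟩ := hs
  have h2 : HasSum (fun n => Nat.casesOn n (0 : ℝ) R : ℕ → ℝ) a := by
    rw [← hasSum_nat_add_iff' 1]
    simpa using ha
  have h3 : HasSum (fun n => (jacobiApply j g n * (starRingEnd ℂ) (g n)).re) (a + a) := by
    convert ha.add h2 using 2 with n
    cases n with
    | zero => simp [jacobiApply, hR]; ring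
    | succ n => simp [jacobiApply, hR]; ring
  have : jacobiForm j g = a + a := h3.tsum_eq
  rw [this]
  convert ha.add ha using 2 with n
  simp only [hR]; ring
end

section

theorem re_mul_conj_le {a b : ℂ} {x y : ℝ} (hx : x = 0 → a = 0) (hy : y = 0 → b = 0)
    (hxy : x * y < 0 → a * y = b * x) :
    (b * (starRingEnd ℂ) a).re ≤ y / x / 2 * ‖a‖ ^ 2 + x / y / 2 * ‖b‖ ^ 2 := by
  rcases eq_or_ne x 0 with rfl | hx0
  · simp [hx rfl]
  rcases eq_or_ne y 0 with rfl | hy0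
  · simp [hy rfl]
  have key : Complex.normSq (a * y - b * x) =
      y ^ 2 * ‖a‖ ^ 2 + x ^ 2 * ‖b‖ ^ 2 - 2 * (x * y) * (b * (starRingEnd ℂ) a).re := by
    rw [← Complex.normSq_eq_norm_sq, ← Complex.normSq_eq_norm_sq]
    simp [Complex.normSq_apply]
    ring
  have hid : y / x / 2 * ‖a‖ ^ 2 + x / y / 2 * ‖b‖ ^ 2 - (b * (starRingEnd ℂ) a).re =
      Complex.normSq (a * y - b * x) / (2 * (x * y)) := by
    rw [key]; field_simp
  rw [← sub_nonneg, hid]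
  rcases lt_or_ge (x * y) 0 with h | h
  · simp [sub_eq_zero.2 (hxy h)]
  · exact div_nonneg (Complex.normSq_nonneg _) (by linarith)

/-- Jacobi's factorization of the form with respect to a solution `ψ` of the comparison equation,
as a bound for the partial sums of the form. -/
theorem jacobi_partial_sum_le {j : ℕ → ℝ} {g : ℕ → ℂ} {ψ : ℕ → ℝ} {s c Q : ℝ} {N : ℕ}
    (hc : 4 * Q ≤ c) (hQ : 0 ≤ Q) (h1 : ψ 1 = (2 * s - c) * ψ 0)
    (hrec : ∀ n : ℕ, ψ (n + 2) + ψ n = (2 * s - c / (n + 2)) * ψ (n + 1))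
    (hj : ∀ n ≥ N, 0 ≤ j (n + 1) - 1 / 2 ∧ (j (n + 1) - 1 / 2) * (n + 2) ≤ Q)
    (hgN : ∀ n < N, g n = 0) (hz : ∀ n, ψ n = 0 → g n = 0)
    (hneg : ∀ n, ψ n * ψ (n + 1) < 0 → g n * ψ (n + 1) = g (n + 1) * ψ n) (M : ℕ) :
    ∑ n ∈ Finset.range M, 2 * j (n + 1) * (g (n + 1) * (starRingEnd ℂ) (g n)).re ≤
      s * ∑ n ∈ Finset.range (M + 1), ‖g n‖ ^ 2
        - (ψ (M + 1) / ψ M / 2 + Q / (M + 1)) * ‖g M‖ ^ 2 := by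
  induction M with
  | zero =>
    rcases eq_or_ne (ψ 0) 0 with h | h
    · simp [hz 0 h]
    · have : ψ 1 / ψ 0 = 2 * s - c := by rw [h1]; field_simp
      simp [this]
      nlinarith [sq_nonneg ‖g 0‖]
  | succ M ih =>
    rw [Finset.sum_range_succ, Finset.sum_range_succ (n := M + 1)]
    have hM1 : (0 : ℝ) < M + 1 := by positivity
    have hM2 : (0 : ℝ) < M + 2 := by positivity
    have hhop : (g (M + 1) * (starRingEnd ℂ) (g M)).re ≤
        ψ (M + 1) / ψ M / 2 * ‖g M‖ ^ 2 + ψ M / ψ (M + 1) / 2 * ‖g (M + 1)‖ ^ 2 :=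
      re_mul_conj_le (hz _) (hz _) (hneg _)
    have hpot : (2 * j (M + 1) - 1) * (g (M + 1) * (starRingEnd ℂ) (g M)).re ≤
        Q / (M + 1) * ‖g M‖ ^ 2 + Q / (M + 2) * ‖g (M + 1)‖ ^ 2 := by
      rcases lt_or_ge M N with h | h
      · simp only [hgN M h, map_zero, mul_zero, Complex.zero_re]
        positivity
      · obtain ⟨ha, hb⟩ := hj M h
        have hd : j (M + 1) - 1 / 2 ≤ Q / (M + 2) := by rwa [le_div_iff₀ hM2]
        have hd' : Q / (M + 2) ≤ Q / (M + 1) := by gcongr; linarith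
        have hre : 2 * (g (M + 1) * (starRingEnd ℂ) (g M)).re ≤
            ‖g M‖ ^ 2 + ‖g (M + 1)‖ ^ 2 := by
          have := (Complex.re_le_norm (g (M + 1) * (starRingEnd ℂ) (g M)))
          rw [norm_mul, RCLike.norm_conj] at this
          nlinarith [sq_nonneg (‖g (M + 1)‖ - ‖g M‖)]
        nlinarith [mul_le_mul_of_nonneg_left hre ha,
          mul_le_mul_of_nonneg_right hd (sq_nonneg ‖g (M + 1)‖),
          mul_le_mul_of_nonneg_right (hd.trans hd') (sq_nonneg ‖g M‖)]
    have hsite : (ψ M / ψ (M + 1) / 2 + ψ (M + 2) / ψ (M + 1) / 2 + 2 * (Q / (M + 2)))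
        * ‖g (M + 1)‖ ^ 2 ≤ s * ‖g (M + 1)‖ ^ 2 := by
      rcases eq_or_ne (ψ (M + 1)) 0 with h | h
      · simp [hz _ h]
      · have e : ψ M / ψ (M + 1) / 2 + ψ (M + 2) / ψ (M + 1) / 2 = s - c / (M + 2) / 2 := by
          have := hrec M
          have e2 : ψ M / ψ (M + 1) / 2 + ψ (M + 2) / ψ (M + 1) / 2
            = (ψ (M + 2) + ψ M) / ψ (M + 1) / 2 := by ring
          rw [e2, this, mul_div_cancel_right₀ _ h]; ring
        have e3 : 4 * (Q / (M + 2)) ≤ c / (M + 2) := by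
          rw [← mul_div_assoc]; gcongr
        refine mul_le_mul_of_nonneg_right ?_ (sq_nonneg _)
        rw [e]; linarith
    have e4 : (((M + 1 : ℕ) : ℝ) + 1) = M + 2 := by push_cast; ring
    rw [e4]
    linarith

/-- A subspace on which the form exceeds `s` is no larger than the number of nodes of a comparison
solution plus the number of coefficients not controlled by the comparison. -/
theorem finrank_le_of_sign_changes {j : ℕ → ℝ} (hbd : ∃ M : ℝ, ∀ n, |j n| ≤ M)
    {ψ : ℕ → ℝ} {s c Q : ℝ} {N : ℕ} (hs : 0 ≤ s)
    (hc : 4 * Q ≤ c) (hQ : 0 ≤ Q) (h1 : ψ 1 = (2 * s - c) * ψ 0)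
    (hrec : ∀ n : ℕ, ψ (n + 2) + ψ n = (2 * s - c / (n + 2)) * ψ (n + 1))
    (hj : ∀ n ≥ N, 0 ≤ j (n + 1) - 1 / 2 ∧ (j (n + 1) - 1 / 2) * (n + 2) ≤ Q)
    {T : Finset ℕ} (hT : ∀ n, ψ n = 0 ∨ ψ n * ψ (n + 1) < 0 → n ∈ T)
    (F : Submodule ℂ (lp (fun _ : ℕ => ℂ) 2)) [FiniteDimensional ℂ F]
    (hF : ∀ g ∈ F, g ≠ 0 → s * ‖g‖ ^ 2 < jacobiForm j (fun n => g n)) :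
    Module.finrank ℂ F ≤ T.card + N := by
  classical
  by_contra hcon
  push Not at hcon
  let ℓ₁ : lp (fun _ : ℕ => ℂ) 2 →ₗ[ℂ] (T → ℂ) :=
    { toFun := fun g n => if ψ n = 0 then g n else g n * ψ (n + 1) - g (n + 1) * ψ n
      map_add' := fun f g => by
        ext n
        simp only [lp.coeFn_add, Pi.add_apply]
        split_ifs <;> ring
      map_smul' := fun a g => by
        ext n
        simp only [lp.coeFn_smul, Pi.smul_apply, smul_eq_mul, RingHom.id_apply]
        split_ifs <;> ring }
  let ℓ₂ : lp (fun _ : ℕ => ℂ) 2 →ₗ[ℂ] (Fin N → ℂ) :=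
    { toFun := fun g n => g n
      map_add' := fun f g => rfl
      map_smul' := fun a g => rfl }
  have hker : LinearMap.ker ((ℓ₁.prod ℓ₂).comp F.subtype) ≠ ⊥ := by
    apply LinearMap.ker_ne_bot_of_finrank_lt
    simpa using hcon
  obtain ⟨⟨g, hgF⟩, hgk, hg0⟩ := (Submodule.ne_bot_iff _).1 hker
  have hg0' : g ≠ 0 := fun h => hg0 (Subtype.ext h)
  have hgk' : ℓ₁ g = 0 ∧ ℓ₂ g = 0 := by
    simpa [LinearMap.mem_ker, Prod.ext_iff] using hgk
  have hgN : ∀ n < N, g n = 0 := fun n hn => congrFun hgk'.2 ⟨n, hn⟩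
  have hcond : ∀ n ∈ T, (if ψ n = 0 then g n else g n * ψ (n + 1) - g (n + 1) * ψ n) = 0 :=
    fun n hn => congrFun hgk'.1 ⟨n, hn⟩
  have hz : ∀ n, ψ n = 0 → g n = 0 := fun n hn => by
    simpa [hn] using hcond n (hT n (Or.inl hn))
  have hneg : ∀ n, ψ n * ψ (n + 1) < 0 → g n * ψ (n + 1) = g (n + 1) * ψ n := fun n hn => by
    have h0 : ψ n ≠ 0 := fun h => by simp [h] at hn
    have := hcond n (hT n (Or.inr hn))
    rw [if_neg h0] at this
    exact sub_eq_zero.1 this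
  have hsum := lp_two_hasSum_norm_sq g
  have hform := (hasSum_jacobiForm hbd hsum.summable).tendsto_sum_nat
  refine (hF g hgF hg0').not_ge (le_of_tendsto hform ?_)
  obtain ⟨M₀, hM₀⟩ := T.exists_nat_subset_range
  filter_upwards [Filter.eventually_ge_atTop M₀] with M hM
  refine (jacobi_partial_sum_le hc hQ h1 hrec hj hgN hz hneg M).trans ?_
  have hpos : 0 ≤ ψ (M + 1) / ψ M := by
    by_contra hlt
    push Not at hlt
    have : ψ M * ψ (M + 1) < 0 := by
      rcases div_neg_iff.1 hlt with h | h <;> nlinarith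
    have := Finset.mem_range.1 (hM₀ (hT M (Or.inr this)))
    omega
  have h2 : ∑ n ∈ Finset.range (M + 1), ‖g n‖ ^ 2 ≤ ‖g‖ ^ 2 :=
    sum_le_hasSum _ (fun _ _ => sq_nonneg _) hsum
  have h3 : 0 ≤ (ψ (M + 1) / ψ M / 2 + Q / (M + 1)) * ‖g M‖ ^ 2 := by positivity
  have := mul_le_mul_of_nonneg_left h2 hs
  linarith

theorem Nplus_le_of_coulomb {j : ℕ → ℝ} (hbd : ∃ M : ℝ, ∀ n, |j n| ≤ M)
    {r s Q : ℝ} {N k : ℕ} (hr0 : 0 < r) (hr1 : r < 1) (hs : r + r⁻¹ = 2 * s)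
    (hQ : 0 ≤ Q) (hk : 4 * Q ≤ (k + 1) * (r⁻¹ - r))
    (hj : ∀ n ≥ N, 0 ≤ j (n + 1) - 1 / 2 ∧ (j (n + 1) - 1 / 2) * (n + 2) ≤ Q) :
    Nplus j s ≤ (k + 1 + N : ℕ) := by
  obtain ⟨T, hTc, hT⟩ := exists_finset_sign_changes hr0 hr1 k
  refine sSup_le ?_
  rintro d ⟨F, hfin, hF, rfl⟩
  have hs0 : 0 ≤ s := by
    have : 0 < r⁻¹ := inv_pos.2 hr0
    linarith
  have hrec : ∀ n : ℕ, coulombSol r (k + 1) (n + 2) + coulombSol r (k + 1) n =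
      (2 * s - (k + 1) * (r⁻¹ - r) / (n + 2)) * coulombSol r (k + 1) (n + 1) := fun n => by
    rw [coulombSol_add_two hr0.ne', hs]; push_cast; rfl
  have h1 : coulombSol r (k + 1) 1 =
      (2 * s - (k + 1) * (r⁻¹ - r)) * coulombSol r (k + 1) 0 := by
    rw [coulombSol_one hr0.ne', hs]
  have := finrank_le_of_sign_changes hbd hs0 hk hQ h1 hrec hj hT F hF
  exact_mod_cast this.trans (by omega)

end

section
open Filter

theorem tendsto_coulombSol {r : ℝ} (h0 : 0 < r) (h1 : r < 1) (k : ℕ) :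
    Tendsto (coulombSol r k) atTop (nhds 0) :=
  (summable_abs_iff.1 (summable_abs_coulombSol h0 h1 k)).tendsto_atTop_zero

theorem summable_coulombSol_mul {r : ℝ} (h0 : 0 < r) (h1 : r < 1) (k l : ℕ) :
    Summable fun n => |coulombSol r k n * coulombSol r l n| := by
  refine Summable.of_norm_bounded_eventually_nat (summable_abs_coulombSol h0 h1 k) ?_
  have h : ∀ᶠ n in atTop, |coulombSol r l n| < 1 :=
    (tendsto_order.1 (by simpa using (tendsto_coulombSol h0 h1 l).abs)).2 1 one_pos
  filter_upwards [h] with n hn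
  rw [Real.norm_eq_abs, abs_abs, abs_mul]
  exact mul_le_of_le_one_right (abs_nonneg _) hn.le

theorem summable_coulombSol_mul_div {r : ℝ} (h0 : 0 < r) (h1 : r < 1) (k l : ℕ) :
    Summable fun n : ℕ => coulombSol r k n * coulombSol r l n / (n + 1) := by
  refine (summable_coulombSol_mul h0 h1 k l).of_norm_bounded fun n => ?_
  have : (0 : ℝ) < n + 1 := by positivity
  rw [Real.norm_eq_abs, abs_div, abs_of_pos this]
  exact div_le_self (abs_nonneg _) (by linarith [(Nat.cast_nonneg n : (0 : ℝ) ≤ n)])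

theorem coulombSol_wronskian {r : ℝ} (h0 : 0 < r) (k l M : ℕ) :
    ((l : ℝ) - k) * (r⁻¹ - r) * ∑ n ∈ Finset.range (M + 1),
      coulombSol r (k + 1) n * coulombSol r (l + 1) n / (n + 1) =
    coulombSol r (k + 1) (M + 1) * coulombSol r (l + 1) M
      - coulombSol r (k + 1) M * coulombSol r (l + 1) (M + 1) := by
  induction M with
  | zero =>
    simp [coulombSol_one h0.ne']
    ring
  | succ M ih =>
    rw [Finset.sum_range_succ, mul_add, ih]
    have hk := coulombSol_add_two h0.ne' (k + 1) M
    have hl := coulombSol_add_two h0.ne' (l + 1) M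
    push_cast at hk hl ⊢
    have e : (M : ℝ) + 1 + 1 = M + 2 := by ring
    rw [e]
    linear_combination coulombSol r (k + 1) (M + 1) * hl - coulombSol r (l + 1) (M + 1) * hk

theorem hasSum_coulombSol_orthogonal {r : ℝ} (h0 : 0 < r) (h1 : r < 1) {k l : ℕ} (hkl : k ≠ l) :
    HasSum (fun n : ℕ => coulombSol r (k + 1) n * coulombSol r (l + 1) n / (n + 1)) 0 := by
  have hs := (summable_coulombSol_mul_div h0 h1 (k + 1) (l + 1)).hasSum
  have hlim := ((tendsto_add_atTop_iff_nat 1).2 hs.tendsto_sum_nat).const_mul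
    (((l : ℝ) - k) * (r⁻¹ - r))
  simp only [coulombSol_wronskian h0] at hlim
  have hk := tendsto_coulombSol h0 h1 (k + 1)
  have hl := tendsto_coulombSol h0 h1 (l + 1)
  have hlim0 := (((tendsto_add_atTop_iff_nat 1).2 hk).mul hl).sub
    (hk.mul ((tendsto_add_atTop_iff_nat 1).2 hl))
  have heq := tendsto_nhds_unique hlim hlim0
  have hne : ((l : ℝ) - k) * (r⁻¹ - r) ≠ 0 := by
    refine mul_ne_zero (sub_ne_zero.2 (by exact_mod_cast hkl.symm)) ?_
    have : 1 < r⁻¹ := (one_lt_inv₀ h0).2 h1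
    linarith
  have hz := (mul_eq_zero.1 (by simpa using heq)).resolve_left hne
  rwa [hz] at hs

/-- The squared norm of `coulombSol r (k + 1)` for the Coulomb weight. -/
noncomputable def coulombWeight (r : ℝ) (k : ℕ) : ℝ :=
  ∑' n : ℕ, coulombSol r (k + 1) n * coulombSol r (k + 1) n / (n + 1)

theorem coulombWeight_pos {r : ℝ} (h0 : 0 < r) (h1 : r < 1) (k : ℕ) : 0 < coulombWeight r k := by
  refine (summable_coulombSol_mul_div h0 h1 _ _).tsum_pos
    (fun n => div_nonneg (mul_self_nonneg _) (by positivity)) 0 ?_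
  have := mul_self_pos.2 (coulombSol_zero_ne_zero h0 h1 k)
  simpa using this

theorem hasSum_coulomb_combination {r : ℝ} (h0 : 0 < r) (h1 : r < 1) {K : ℕ} (a b : Fin K → ℂ) :
    HasSum (fun n : ℕ => ((∑ k : Fin K, b k * coulombSol r (k + 1) n) *
      (starRingEnd ℂ) (∑ k : Fin K, a k * coulombSol r (k + 1) n)).re / (n + 1))
      (∑ k : Fin K, (b k * (starRingEnd ℂ) (a k)).re * coulombWeight r k) := by
  have hB : ∀ k l : Fin K, HasSum
      (fun n : ℕ => (b k * (starRingEnd ℂ) (a l)).re *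
        (coulombSol r (k + 1) n * coulombSol r (l + 1) n / (n + 1)))
      (if k = l then (b k * (starRingEnd ℂ) (a k)).re * coulombWeight r k else 0) := by
    intro k l
    split_ifs with h
    · subst h
      exact (summable_coulombSol_mul_div h0 h1 _ _).hasSum.mul_left _
    · simpa using (hasSum_coulombSol_orthogonal h0 h1 (Fin.val_ne_of_ne h)).mul_left
        (b k * (starRingEnd ℂ) (a l)).re
  have hsum := hasSum_sum (s := Finset.univ) fun k _ =>
    hasSum_sum (s := Finset.univ) fun l _ => hB k l
  simp only [Finset.sum_ite_eq, Finset.mem_univ, if_true] at hsum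
  convert hsum using 2 with n
  rw [map_sum, Finset.sum_mul_sum, Complex.re_sum, Finset.sum_div]
  refine Finset.sum_congr rfl fun k _ => ?_
  rw [Complex.re_sum, Finset.sum_div]
  refine Finset.sum_congr rfl fun l _ => ?_
  simp
  ring

theorem jacobiApply_half_combination {r τ : ℝ} (h0 : 0 < r) (hτ : r + r⁻¹ = 2 * τ) {K : ℕ}
    (a : Fin K → ℂ) (n : ℕ) :
    jacobiApply (fun _ => 1 / 2) (fun n => ∑ k : Fin K, a k * coulombSol r (k + 1) n) n =
      τ * ∑ k : Fin K, a k * coulombSol r (k + 1) n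
      - (∑ k : Fin K, (((k : ℝ) + 1) * (r⁻¹ - r) * a k) * coulombSol r (k + 1) n)
        / (2 * (n + 1)) := by
  cases n with
  | zero =>
    simp only [jacobiApply, coulombSol_one h0.ne', hτ, Finset.mul_sum, Finset.sum_div,
      ← Finset.sum_sub_distrib]
    refine Finset.sum_congr rfl fun k _ => ?_
    push_cast
    ring
  | succ n =>
    simp only [jacobiApply, Finset.mul_sum, Finset.sum_div, ← Finset.sum_sub_distrib,
      ← Finset.sum_add_distrib]
    refine Finset.sum_congr rfl fun k _ => ?_
    have := coulombSol_add_two h0.ne' (k + 1) n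
    rw [hτ] at this
    have := congrArg (fun x : ℝ => (x : ℂ)) this
    push_cast at this ⊢
    have hn : (n : ℂ) + 1 + 1 = n + 2 := by ring
    rw [hn]
    have hd : (k + 1 : ℂ) * ((r : ℂ)⁻¹ - r) * a k * coulombSol r (k + 1) (n + 1) / (2 * (n + 2)) =
      a k / 2 * ((k + 1 : ℂ) * ((r : ℂ)⁻¹ - r) / (n + 2) * coulombSol r (k + 1) (n + 1)) := by
      have : (n : ℂ) + 2 ≠ 0 := by exact_mod_cast (by omega : n + 2 ≠ 0)
      field_simp
    rw [hd]
    linear_combination a k / 2 * this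

theorem jacobiForm_half_combination {r τ : ℝ} (h0 : 0 < r) (h1 : r < 1) (hτ : r + r⁻¹ = 2 * τ)
    {K : ℕ} (a : Fin K → ℂ) {S : ℝ}
    (hS : HasSum (fun n => ‖∑ k : Fin K, a k * coulombSol r (k + 1) n‖ ^ 2) S) :
    jacobiForm (fun _ => 1 / 2) (fun n => ∑ k : Fin K, a k * coulombSol r (k + 1) n) =
      τ * S - 1 / 2 * ∑ k : Fin K, ((k : ℝ) + 1) * (r⁻¹ - r) * (‖a k‖ ^ 2 * coulombWeight r k) := by
  have hc := hasSum_coulomb_combination h0 h1 a fun k => ((k : ℝ) + 1) * (r⁻¹ - r) * a k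
  have := (hS.mul_left τ).sub (hc.mul_left (1 / 2))
  have e : ∑ k : Fin K, ((k : ℝ) + 1) * (r⁻¹ - r) * (‖a k‖ ^ 2 * coulombWeight r k) =
      ∑ k : Fin K, ((((k : ℝ) + 1) * (r⁻¹ - r) * a k : ℂ) * (starRingEnd ℂ) (a k)).re *
        coulombWeight r k := by
    refine Finset.sum_congr rfl fun k _ => ?_
    rw [mul_assoc _ (a k), Complex.mul_conj, Complex.normSq_eq_norm_sq]
    norm_cast
    ring
  rw [e, jacobiForm, ← this.tsum_eq]
  refine tsum_congr fun n => ?_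
  rw [jacobiApply_half_combination h0 hτ, sub_mul, mul_assoc, Complex.mul_conj,
    Complex.normSq_eq_norm_sq, Complex.sub_re]
  congr 1
  · norm_cast
  · rw [div_mul_eq_mul_div]
    have : (2 * ((n : ℂ) + 1)) = ((2 * ((n : ℝ) + 1) : ℝ) : ℂ) := by push_cast; rfl
    rw [this, Complex.div_ofReal_re]
    have half_div : ∀ A B : ℝ, A / (2 * B) = 1 / 2 * (A / B) := fun A B => by ring
    exact half_div _ _

/-- `coulombSol r (k + 1)` as an element of `ℓ²`. -/
noncomputable def coulombVec {r : ℝ} (h0 : 0 < r) (h1 : r < 1) (k : ℕ) :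
    lp (fun _ : ℕ => ℂ) 2 :=
  ⟨fun n => (coulombSol r (k + 1) n : ℂ), memℓp_gen (by
    refine (summable_coulombSol_mul h0 h1 (k + 1) (k + 1)).congr fun n => ?_
    simp [pow_two])⟩

theorem coulombVec_combination_apply {r : ℝ} (h0 : 0 < r) (h1 : r < 1) {K : ℕ} (a : Fin K → ℂ)
    (n : ℕ) :
    (Fintype.linearCombination ℂ (fun k : Fin K => coulombVec h0 h1 k) a) n =
      ∑ k : Fin K, a k * coulombSol r (k + 1) n := by
  rw [Fintype.linearCombination_apply, lp.coeFn_sum, Finset.sum_apply]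
  rfl

theorem lt_jacobiForm_combination {j : ℕ → ℝ} (hbd : ∃ M : ℝ, ∀ n, |j n| ≤ M)
    {r s τ ε Q : ℝ} {N K : ℕ} (h0 : 0 < r) (h1 : r < 1) (hτ : r + r⁻¹ = 2 * τ) (hε : 0 ≤ ε)
    (hs : (1 + ε) * τ - ε = s) (hQ : 0 ≤ Q) (hK : (1 + ε) * (K * (r⁻¹ - r)) < 4 * Q)
    (hj : ∀ n ≥ N, Q / (n + 1) ≤ j (n + 1) - 1 / 2 ∧ j (n + 1) - 1 / 2 ≤ ε / 2)
    {a : Fin K → ℂ} (ha : a ≠ 0) {g : lp (fun _ : ℕ => ℂ) 2}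
    (hg : ∀ n, g n = ∑ k : Fin K, a k * coulombSol r (k + 1) n) (hgN : ∀ n ≤ N, g n = 0) :
    s * ‖g‖ ^ 2 < jacobiForm j (fun n => g n) := by
  have hS := lp_two_hasSum_norm_sq g
  have hform := hasSum_jacobiForm hbd hS.summable
  have hhalf := hasSum_jacobiForm (j := fun _ => 1 / 2) ⟨|1 / 2|, fun _ => le_rfl⟩ hS.summable
  have hval : jacobiForm (fun _ => 1 / 2) (fun n => g n) = τ * ‖g‖ ^ 2 -
      1 / 2 * ∑ k : Fin K, ((k : ℝ) + 1) * (r⁻¹ - r) * (‖a k‖ ^ 2 * coulombWeight r k) := by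
    have := jacobiForm_half_combination h0 h1 hτ a (S := ‖g‖ ^ 2) (by simpa only [hg] using hS)
    simpa only [hg] using this
  have hW : HasSum (fun n : ℕ => ‖g n‖ ^ 2 / (n + 1))
      (∑ k : Fin K, ‖a k‖ ^ 2 * coulombWeight r k) := by
    have := hasSum_coulomb_combination h0 h1 a a
    simp only [← hg, Complex.mul_conj, Complex.normSq_eq_norm_sq, Complex.ofReal_re] at this
    exact this
  set W := ∑ k : Fin K, ‖a k‖ ^ 2 * coulombWeight r k with hWdef
  set V := ∑ k : Fin K, ((k : ℝ) + 1) * (r⁻¹ - r) * (‖a k‖ ^ 2 * coulombWeight r k) with hVdef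
  have hg0 : g 0 = 0 := hgN 0 (Nat.zero_le _)
  have hS' : HasSum (fun n => ‖g (n + 1)‖ ^ 2) (‖g‖ ^ 2) := by
    have := (hasSum_nat_add_iff' (f := fun n => ‖g n‖ ^ 2) 1).2 hS
    simpa [hg0] using this
  have hW' : HasSum (fun n : ℕ => ‖g (n + 1)‖ ^ 2 / (n + 2)) W := by
    have := (hasSum_nat_add_iff' (f := fun n : ℕ => ‖g n‖ ^ 2 / (n + 1)) 1).2 hW
    simp only [Finset.range_one, Finset.sum_singleton, hg0, norm_zero, ne_eq, OfNat.ofNat_ne_zero,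
      not_false_eq_true, zero_pow, zero_div, sub_zero] at this
    have e : ∀ n : ℕ, ((n + 1 : ℕ) : ℝ) + 1 = n + 2 := fun n => by push_cast; ring
    simpa only [e] using this
  have hlow := (hhalf.mul_left (1 + ε)).add
    (((hW.add hW').mul_left Q).sub ((hS.add hS').mul_left (ε / 2)))
  have hle := hasSum_le (fun n => ?_) hlow hform
  · have hr : 0 < r⁻¹ - r := by
      have : 1 < r⁻¹ := (one_lt_inv₀ h0).2 h1
      linarith
    have hVW : V ≤ K * (r⁻¹ - r) * W := by
      rw [hVdef, hWdef, Finset.mul_sum]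
      refine Finset.sum_le_sum fun k _ => ?_
      have hkK : (k : ℝ) + 1 ≤ K := by exact_mod_cast k.2
      exact mul_le_mul_of_nonneg_right (mul_le_mul_of_nonneg_right hkK hr.le)
        (mul_nonneg (sq_nonneg _) (coulombWeight_pos h0 h1 _).le)
    have hWpos : 0 < W := by
      obtain ⟨k, hk⟩ := Function.ne_iff.1 ha
      refine Finset.sum_pos' (fun i _ => mul_nonneg (sq_nonneg _) (coulombWeight_pos h0 h1 _).le)
        ⟨k, Finset.mem_univ _, mul_pos (pow_pos (norm_pos_iff.2 hk) 2) (coulombWeight_pos h0 h1 _)⟩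
    rw [hval] at hle
    rw [← hs]
    have h3 := mul_lt_mul_of_pos_right hK hWpos
    have h4 := mul_le_mul_of_nonneg_left hVW (by linarith : 0 ≤ 1 + ε)
    nlinarith
  · rcases lt_or_ge n N with h | h
    · simp [hgN n h.le, hgN (n + 1) h]
    · obtain ⟨hlo, hhi⟩ := hj n h
      have hre : 2 * (g (n + 1) * (starRingEnd ℂ) (g n)).re ≤ ‖g n‖ ^ 2 + ‖g (n + 1)‖ ^ 2 := by
        have := (Complex.re_le_norm (g (n + 1) * (starRingEnd ℂ) (g n)))
        rw [norm_mul, RCLike.norm_conj] at this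
        nlinarith [sq_nonneg (‖g (n + 1)‖ - ‖g n‖)]
      have hlo' : Q / (n + 2) ≤ j (n + 1) - 1 / 2 := by
        refine le_trans ?_ hlo
        gcongr
        norm_num
      have e1 : ‖g n‖ ^ 2 / ((n : ℝ) + 1) * Q = Q / (n + 1) * ‖g n‖ ^ 2 := by ring
      have e2 : ‖g (n + 1)‖ ^ 2 / ((n : ℝ) + 2) * Q = Q / (n + 2) * ‖g (n + 1)‖ ^ 2 := by ring
      have i1 := mul_le_mul_of_nonneg_right hlo (sq_nonneg ‖g n‖)
      have i2 := mul_le_mul_of_nonneg_right hlo' (sq_nonneg ‖g (n + 1)‖)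
      have i3 := mul_le_mul_of_nonneg_left hre (by linarith : 0 ≤ ε / 2 - (j (n + 1) - 1 / 2))
      simp only
      nlinarith

theorem le_Nplus_of_coulomb {j : ℕ → ℝ} (hbd : ∃ M : ℝ, ∀ n, |j n| ≤ M)
    {r s τ ε Q : ℝ} {N K : ℕ} (h0 : 0 < r) (h1 : r < 1) (hτ : r + r⁻¹ = 2 * τ) (hε : 0 ≤ ε)
    (hs : (1 + ε) * τ - ε = s) (hQ : 0 ≤ Q) (hK : (1 + ε) * (K * (r⁻¹ - r)) < 4 * Q)
    (hj : ∀ n ≥ N, Q / (n + 1) ≤ j (n + 1) - 1 / 2 ∧ j (n + 1) - 1 / 2 ≤ ε / 2) :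
    ((K - (N + 1) : ℕ) : ℕ∞) ≤ Nplus j s := by
  set S := Fintype.linearCombination ℂ (fun k : Fin K => coulombVec h0 h1 k) with hSdef
  have hSa : ∀ a n, (S a) n = ∑ k : Fin K, a k * coulombSol r (k + 1) n :=
    coulombVec_combination_apply h0 h1
  let P : (Fin K → ℂ) →ₗ[ℂ] (Fin (N + 1) → ℂ) :=
    { toFun := fun a n => (S a) n
      map_add' := fun a b => by rw [map_add]; rfl
      map_smul' := fun c a => by rw [map_smul]; rfl }
  have hinj : Function.Injective S := by
    rw [← LinearMap.ker_eq_bot, LinearMap.ker_eq_bot']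
    intro a ha
    by_contra hne
    have hW := hasSum_coulomb_combination h0 h1 a a
    simp only [← hSa, ha, lp.coeFn_zero, Pi.zero_apply, zero_mul, Complex.zero_re, zero_div,
      Complex.mul_conj, Complex.normSq_eq_norm_sq, Complex.ofReal_re] at hW
    obtain ⟨k, hk⟩ := Function.ne_iff.1 hne
    have : 0 < ∑ k : Fin K, ‖a k‖ ^ 2 * coulombWeight r k :=
      Finset.sum_pos' (fun i _ => mul_nonneg (sq_nonneg _) (coulombWeight_pos h0 h1 _).le)
        ⟨k, Finset.mem_univ _, mul_pos (pow_pos (norm_pos_iff.2 hk) 2) (coulombWeight_pos h0 h1 _)⟩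
    exact this.ne (hasSum_zero.unique hW)
  have hrank : K - (N + 1) ≤ Module.finrank ℂ ((LinearMap.ker P).map S) := by
    rw [← (Submodule.equivMapOfInjective S hinj (LinearMap.ker P)).finrank_eq]
    have hadd := P.finrank_range_add_finrank_ker
    have hle := Submodule.finrank_le (LinearMap.range P)
    simp only [Module.finrank_fin_fun] at hadd hle
    omega
  refine (Nat.cast_le.2 hrank).trans (le_sSup ⟨_, inferInstance, ?_, rfl⟩)
  rintro _ ⟨a, haP, rfl⟩ hne
  refine lt_jacobiForm_combination hbd h0 h1 hτ hε hs hQ hK hj (a := a) ?_ (hSa a) ?_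
  · rintro rfl
    exact hne (map_zero _)
  · intro n hn
    exact congrFun (LinearMap.mem_ker.1 haP) ⟨n, Nat.lt_succ_of_le hn⟩

end

section
open Filter Topology

theorem exists_add_inv_eq {τ : ℝ} (hτ : 1 < τ) :
    ∃ r : ℝ, 0 < r ∧ r < 1 ∧ r + r⁻¹ = 2 * τ ∧ r⁻¹ - r = 2 * √(τ ^ 2 - 1) := by
  have h : 0 < τ ^ 2 - 1 := by nlinarith
  have hd := Real.sqrt_pos.2 h
  have hsq := Real.sq_sqrt h.le
  set d := √(τ ^ 2 - 1)
  have hinv : (τ - d)⁻¹ = τ + d := inv_eq_of_mul_eq_one_right (by nlinarith)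
  have h0 : 0 < τ - d := by nlinarith
  refine ⟨τ - d, h0, by nlinarith, ?_, ?_⟩ <;> rw [hinv] <;> ring

theorem Nplus_le_nat {j : ℕ → ℝ} (hbd : ∃ M : ℝ, ∀ n, |j n| ≤ M) {s Q : ℝ} {N : ℕ} (hs : 1 < s)
    (hQ : 0 ≤ Q) (hj : ∀ n ≥ N, 0 ≤ j (n + 1) - 1 / 2 ∧ (j (n + 1) - 1 / 2) * (n + 2) ≤ Q) :
    ∃ m : ℕ, Nplus j s ≤ m ∧ (m : ℝ) ≤ 2 * Q / √(s ^ 2 - 1) + (N + 2) := by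
  obtain ⟨r, h0, h1, hr, hd⟩ := exists_add_inv_eq hs
  have hpos : 0 < √(s ^ 2 - 1) := Real.sqrt_pos.2 (by nlinarith)
  have hle := Nat.le_ceil (2 * Q / √(s ^ 2 - 1))
  have hlt := Nat.ceil_lt_add_one (a := 2 * Q / √(s ^ 2 - 1)) (by positivity)
  refine ⟨_, Nplus_le_of_coulomb hbd h0 h1 hr hQ (k := ⌈2 * Q / √(s ^ 2 - 1)⌉₊) ?_ hj, ?_⟩
  · rw [hd]
    rw [div_le_iff₀ hpos] at hle
    nlinarith
  · push_cast
    linarith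

theorem exists_nat_le_Nplus {j : ℕ → ℝ} (hbd : ∃ M : ℝ, ∀ n, |j n| ≤ M) {s τ ε Q : ℝ} {N : ℕ}
    (hτ : 1 < τ) (hε : 0 ≤ ε) (hs : (1 + ε) * τ - ε = s) (hQ : 0 < Q)
    (hj : ∀ n ≥ N, Q / (n + 1) ≤ j (n + 1) - 1 / 2 ∧ j (n + 1) - 1 / 2 ≤ ε / 2) :
    ∃ m : ℕ, (m : ℕ∞) ≤ Nplus j s ∧ 2 * Q / ((1 + ε) * √(τ ^ 2 - 1)) - (N + 2) ≤ m := by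
  obtain ⟨r, h0, h1, hr, hd⟩ := exists_add_inv_eq hτ
  have hpos : 0 < √(τ ^ 2 - 1) := Real.sqrt_pos.2 (by nlinarith)
  have hε1 : 0 < 1 + ε := by linarith
  set x := 2 * Q / ((1 + ε) * √(τ ^ 2 - 1)) with hx
  have hx0 : 0 < x := by positivity
  have hle := Nat.le_ceil x
  have hlt := Nat.ceil_lt_add_one hx0.le
  obtain ⟨K, hK⟩ := Nat.exists_eq_succ_of_ne_zero (Nat.ceil_pos.2 hx0).ne'
  rw [hK] at hle hlt
  push_cast at hle hlt
  refine ⟨_, le_Nplus_of_coulomb hbd h0 h1 hr hε hs hQ.le (K := K) ?_ hj, ?_⟩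
  · rw [hd]
    have : (K : ℝ) < x := by linarith
    rw [hx, lt_div_iff₀ (by positivity)] at this
    linarith
  · have : (K : ℝ) ≤ ((K - (N + 1) : ℕ) : ℝ) + (N + 1) := by
      exact_mod_cast le_tsub_add
    linarith

end

/-- If `q > 0` and the bounded real off-diagonal entries satisfy
`j_n = 1/2 + (q/n)(1 + o(1))` (i.e. `n(j_n − 1/2) → q`), then
`N₊(s; J) ∼ q√2/√(s−1)` as `s ↘ 1`, i.e. `√(s−1)·N₊(s; J) → q√2`. -/
theorem stmt13 (q : ℝ) (hq : 0 < q) (j : ℕ → ℝ) (hbd : ∃ M : ℝ, ∀ n, |j n| ≤ M)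
    (hj : Filter.Tendsto (fun n : ℕ => (n : ℝ) * (j n - 1/2)) Filter.atTop (nhds q)) :
    Filter.Tendsto (fun s : ℝ => Real.sqrt (s - 1) * ((Nplus j s).toNat : ℝ))
      (nhdsWithin 1 (Set.Ioi 1)) (nhds (q * Real.sqrt 2)) := by
  have hδq : Filter.Tendsto (fun n : ℕ => ((n : ℝ) + 1) * (j (n + 1) - 1 / 2)) Filter.atTop
      (nhds q) := by
    simpa using (Filter.tendsto_add_atTop_iff_nat 1).2 hj
  have hδ0 : Filter.Tendsto (fun n : ℕ => j (n + 1) - 1 / 2) Filter.atTop (nhds 0) := by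
    have := hδq.mul tendsto_one_div_add_atTop_nhds_zero_nat
    rw [mul_zero] at this
    refine this.congr fun n => ?_
    have : (n : ℝ) + 1 ≠ 0 := by positivity
    field_simp
  have hδq2 : Filter.Tendsto (fun n : ℕ => (j (n + 1) - 1 / 2) * ((n : ℝ) + 2)) Filter.atTop
      (nhds q) := by
    have := hδq.add hδ0
    rw [add_zero] at this
    exact this.congr fun n => by ring
  have hδpos : ∀ᶠ n : ℕ in Filter.atTop, 0 ≤ j (n + 1) - 1 / 2 := by
    filter_upwards [(tendsto_order.1 hδq).1 0 hq] with n hn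
    have : (0 : ℝ) < n + 1 := by positivity
    exact (pos_of_mul_pos_right hn this.le).le
  have hupper : ∀ Q, q < Q → ∃ N : ℕ, ∀ n ≥ N,
      0 ≤ j (n + 1) - 1 / 2 ∧ (j (n + 1) - 1 / 2) * (n + 2) ≤ Q := fun Q hQ =>
    Filter.eventually_atTop.1
      (hδpos.and (((tendsto_order.1 hδq2).2 Q hQ).mono fun _ h => h.le))
  have hsq2 : √(2 : ℝ) * √2 = 2 := Real.mul_self_sqrt zero_le_two
  have hsq2pos : 0 < √(2 : ℝ) := by positivity
  have hroot : Filter.Tendsto (fun s : ℝ => √(s - 1)) (nhdsWithin 1 (Set.Ioi 1)) (nhds 0) := by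
    have : Filter.Tendsto (fun s : ℝ => √(s - 1)) (nhds 1) (nhds √(1 - 1)) :=
      (by fun_prop : Continuous fun s : ℝ => √(s - 1)).tendsto 1
    rw [sub_self, Real.sqrt_zero] at this
    exact this.mono_left nhdsWithin_le_nhds
  refine tendsto_order.2 ⟨fun a ha => ?_, fun b hb => ?_⟩
  · obtain ⟨ε, hε0, hεq, hεa⟩ : ∃ ε : ℝ, 0 < ε ∧ ε < q ∧
        a < 2 * (q - ε) / ((1 + ε) * √(2 / (1 + ε))) := by
      have hc : ContinuousAt (fun ε : ℝ => 2 * (q - ε) / ((1 + ε) * √(2 / (1 + ε)))) 0 := by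
        refine ContinuousAt.div (by fun_prop) (ContinuousAt.mul (by fun_prop)
          (ContinuousAt.sqrt (ContinuousAt.div (by fun_prop) (by fun_prop) (by norm_num)))) ?_
        norm_num
      have hval : 2 * (q - 0) / ((1 + 0) * √(2 / (1 + 0))) = q * √2 := by
        rw [add_zero, div_one, one_mul, sub_zero, div_eq_iff hsq2pos.ne']
        linear_combination -q * hsq2
      have h1 := (tendsto_order.1 hc.tendsto).1 a (by rw [hval]; exact ha)
      have h2 : ∀ᶠ ε : ℝ in nhds 0, ε < q := eventually_lt_nhds hq
      obtain ⟨ε, ⟨hε1, hε2⟩, hε3⟩ := (((h1.and h2).filter_mono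
        (nhdsWithin_le_nhds (s := Set.Ioi 0))).and self_mem_nhdsWithin).exists
      exact ⟨ε, hε3, hε2, hε1⟩
    have hε1 : 0 < 1 + ε := by linarith
    obtain ⟨N₁, hN₁⟩ := hupper (q + 1) (by linarith)
    obtain ⟨N, hN⟩ : ∃ N : ℕ, ∀ n ≥ N,
        (q - ε) / (n + 1) ≤ j (n + 1) - 1 / 2 ∧ j (n + 1) - 1 / 2 ≤ ε / 2 := by
      refine Filter.eventually_atTop.1 ?_
      filter_upwards [(tendsto_order.1 hδq).1 (q - ε) (by linarith),
        (tendsto_order.1 hδ0).2 (ε / 2) (by linarith)] with n hn hn'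
      have : (0 : ℝ) < n + 1 := by positivity
      exact ⟨by rw [div_le_iff₀ this]; linarith, hn'.le⟩
    have hlim : Filter.Tendsto (fun s : ℝ => 2 * (q - ε) /
        ((1 + ε) * √(((s + ε) / (1 + ε) + 1) / (1 + ε))) - √(s - 1) * (N + 2))
        (nhdsWithin 1 (Set.Ioi 1)) (nhds (2 * (q - ε) / ((1 + ε) * √(2 / (1 + ε))))) := by
      have hc : ContinuousAt (fun s : ℝ => 2 * (q - ε) /
          ((1 + ε) * √(((s + ε) / (1 + ε) + 1) / (1 + ε)))) 1 := by
        refine ContinuousAt.div (by fun_prop) (by fun_prop) ?_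
        positivity
      have := (hc.tendsto.mono_left (nhdsWithin_le_nhds (s := Set.Ioi 1))).sub
        (hroot.mul_const ((N : ℝ) + 2))
      rwa [zero_mul, sub_zero, div_self hε1.ne', one_add_one_eq_two] at this
    filter_upwards [(tendsto_order.1 hlim).1 a hεa, self_mem_nhdsWithin] with s hsa hs
    have hs1 : 0 < s - 1 := sub_pos.2 hs
    have hτ : 1 < (s + ε) / (1 + ε) := by rw [lt_div_iff₀ hε1]; linarith
    obtain ⟨m, hm, hmx⟩ := exists_nat_le_Nplus (s := s) hbd hτ hε0.le
      (by field_simp; ring) (sub_pos.2 hεq) hN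
    obtain ⟨m', hm', -⟩ := Nplus_le_nat hbd hs (by linarith) hN₁
    have hmN : m ≤ (Nplus j s).toNat :=
      ENat.toNat_le_toNat hm (ne_top_of_le_ne_top (ENat.natCast_ne_top m') hm')
    refine hsa.trans_le ?_
    have hsqrt : √(((s + ε) / (1 + ε)) ^ 2 - 1) =
        √(s - 1) * √(((s + ε) / (1 + ε) + 1) / (1 + ε)) := by
      rw [← Real.sqrt_mul hs1.le]
      congr 1
      field_simp
      ring
    have hrs : 0 < √(s - 1) := Real.sqrt_pos.2 hs1
    have hD : 0 < √(((s + ε) / (1 + ε) + 1) / (1 + ε)) := Real.sqrt_pos.2 (by positivity)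
    rw [hsqrt] at hmx
    calc _ = √(s - 1) * (2 * (q - ε) / ((1 + ε) *
            (√(s - 1) * √(((s + ε) / (1 + ε) + 1) / (1 + ε)))) - (N + 2)) := by
          field_simp
      _ ≤ √(s - 1) * m := mul_le_mul_of_nonneg_left hmx hrs.le
      _ ≤ _ := mul_le_mul_of_nonneg_left (by exact_mod_cast hmN) hrs.le
  · obtain ⟨Q, hqQ, hQb⟩ : ∃ Q, q < Q ∧ Q < b / √2 :=
      exists_between ((lt_div_iff₀ hsq2pos).2 hb)
    rw [lt_div_iff₀ hsq2pos] at hQb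
    obtain ⟨N, hN⟩ := hupper Q hqQ
    have hlim : Filter.Tendsto (fun s : ℝ => 2 * Q / √(s + 1) + √(s - 1) * (N + 2))
        (nhdsWithin 1 (Set.Ioi 1)) (nhds (Q * √2)) := by
      have hc : ContinuousAt (fun s : ℝ => 2 * Q / √(s + 1)) 1 :=
        ContinuousAt.div (by fun_prop) (by fun_prop) (by positivity)
      have := (hc.tendsto.mono_left (nhdsWithin_le_nhds (s := Set.Ioi 1))).add
        (hroot.mul_const ((N : ℝ) + 2))
      have hval : 2 * Q / √2 = Q * √2 := by
        rw [div_eq_iff hsq2pos.ne']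
        linear_combination -Q * hsq2
      rwa [zero_mul, add_zero, one_add_one_eq_two, hval] at this
    filter_upwards [(tendsto_order.1 hlim).2 b hQb, self_mem_nhdsWithin] with s hsb hs
    have hs1 : 0 < s - 1 := sub_pos.2 hs
    obtain ⟨m, hm, hmx⟩ := Nplus_le_nat hbd hs (by linarith) hN
    have hmN : (Nplus j s).toNat ≤ m := ENat.toNat_le_of_le_natCast hm
    refine lt_of_le_of_lt ?_ hsb
    have hsqrt : √(s ^ 2 - 1) = √(s - 1) * √(s + 1) := by
      rw [← Real.sqrt_mul hs1.le]
      congr 1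
      ring
    have hrs : 0 < √(s - 1) := Real.sqrt_pos.2 hs1
    have hD : 0 < √(s + 1) := Real.sqrt_pos.2 (by linarith)
    rw [hsqrt] at hmx
    calc _ ≤ √(s - 1) * m := mul_le_mul_of_nonneg_left (by exact_mod_cast hmN) hrs.le
      _ ≤ √(s - 1) * (2 * Q / (√(s - 1) * √(s + 1)) + (N + 2)) :=
          mul_le_mul_of_nonneg_left hmx hrs.le
      _ = _ := by field_simp
end

section
/- Let (λ_k)_{k≥1} be a nonincreasing sequence of real numbers with λ_k > 1 for all k and k²·(λ_k − 1) → c as k → ∞, for some constant c > 0. Then √(s−1) · #{k ∈ ℕ : λ_k > s} → √c as s ↘ 1. -/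
open Filter Topology

/-- A sequence with `k² (λ_k − 1)` convergent tends to `1`. -/
lemma tendsto_one_of_tendsto_sq_mul_sub_one {lam : ℕ → ℝ} {c : ℝ}
    (hlim : Tendsto (fun k : ℕ => (k : ℝ) ^ 2 * (lam k - 1)) atTop (𝓝 c)) :
    Tendsto lam atTop (𝓝 1) := by
  have hinv : Tendsto (fun k : ℕ => ((k : ℝ)⁻¹) ^ 2) atTop (𝓝 0) := by
    simpa using (tendsto_inv_atTop_nhds_zero_nat (𝕜 := ℝ)).pow 2
  have h := (hlim.mul hinv).add_const 1
  rw [mul_zero, zero_add] at h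
  refine h.congr' ?_
  filter_upwards [eventually_ge_atTop 1] with k hk
  have hk0 : (k : ℝ) ≠ 0 := by positivity
  field_simp
  ring

/-- The superlevel sets of a nonincreasing sequence that is eventually at most `s` are
initial segments. -/
lemma superlevel_eq_Icc {lam : ℕ → ℝ} (hanti : ∀ k : ℕ, 1 ≤ k → lam (k + 1) ≤ lam k) {s : ℝ}
    (hs : ∃ n : ℕ, lam (n + 1) ≤ s) :
    ∃ n : ℕ, {k : ℕ | 1 ≤ k ∧ s < lam k} = Set.Icc 1 n ∧ lam (n + 1) ≤ s := by
  classical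
  refine ⟨Nat.find hs, ?_, Nat.find_spec hs⟩
  ext k
  simp only [Set.mem_ofPred_eq, Set.mem_Icc]
  refine and_congr_right fun hk => ⟨fun h => ?_, fun h => ?_⟩
  · by_contra! hlt
    have hle : lam k ≤ lam (Nat.find hs + 1) :=
      Nat.le_induction le_rfl (fun m hm ih => (hanti m (by omega)).trans ih) k hlt
    exact absurd (hle.trans (Nat.find_spec hs)) (not_le.mpr h)
  · obtain ⟨m, rfl⟩ := Nat.exists_eq_add_of_le' hk
    exact not_le.mp (Nat.find_min hs (by omega))

/-- Let `(λ_k)_{k≥1}` be nonincreasing with `λ_k > 1` and `k²(λ_k − 1) → c > 0`.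
Then `√(s−1)·#{k ≥ 1 : λ_k > s} → √c` as `s ↘ 1`. -/
theorem stmt14 (lam : ℕ → ℝ) (c : ℝ) (hc : 0 < c)
    (hmono : ∀ k : ℕ, 1 ≤ k → lam (k + 1) ≤ lam k)
    (hgt : ∀ k : ℕ, 1 ≤ k → 1 < lam k)
    (hlim : Filter.Tendsto (fun k : ℕ => (k : ℝ) ^ 2 * (lam k - 1))
      Filter.atTop (nhds c)) :
    Filter.Tendsto
      (fun s : ℝ => Real.sqrt (s - 1) * (Nat.card {k : ℕ | 1 ≤ k ∧ s < lam k} : ℝ))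
      (nhdsWithin 1 (Set.Ioi 1)) (nhds (Real.sqrt c)) := by
  set N : ℝ → ℕ := fun s => Nat.card {k : ℕ | 1 ≤ k ∧ s < lam k} with hN
  have hset : ∀ s : ℝ, 1 < s →
      {k : ℕ | 1 ≤ k ∧ s < lam k} = Set.Icc 1 (N s) ∧ lam (N s + 1) ≤ s := by
    intro s hs
    have hev := (tendsto_one_of_tendsto_sq_mul_sub_one hlim).comp (tendsto_add_atTop_nat 1)
    obtain ⟨n, hn, hle⟩ :=
      superlevel_eq_Icc hmono ((hev.eventually (eventually_le_nhds hs)).exists)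
    have hNn : N s = n := by
      simp only [hN]
      rw [hn]
      simp
    rw [hNn]
    exact ⟨hn, hle⟩
  have hNtop : Tendsto N (𝓝[>] 1) atTop := by
    refine tendsto_atTop.mpr fun K => ?_
    have hK := hgt (K + 1) (by omega)
    filter_upwards [self_mem_nhdsWithin, nhdsWithin_le_nhds (eventually_lt_nhds hK)] with s hs hsK
    have hmem : K + 1 ∈ {k : ℕ | 1 ≤ k ∧ s < lam k} := ⟨by omega, hsK⟩
    rw [(hset s hs).1, Set.mem_Icc] at hmem
    omega
  have hlower : Tendsto (fun n : ℕ => (n : ℝ) ^ 2 * (lam (n + 1) - 1)) atTop (𝓝 c) := by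
    have hratio := (tendsto_natCast_div_add_atTop (1 : ℝ)).pow 2
    have h := hratio.mul (hlim.comp (tendsto_add_atTop_nat 1))
    rw [one_pow, one_mul] at h
    refine h.congr fun n => ?_
    have hn : (n : ℝ) + 1 ≠ 0 := by positivity
    simp only [Function.comp_apply, Nat.cast_add, Nat.cast_one]
    field_simp
  have hsq : Tendsto (fun s : ℝ => (N s : ℝ) ^ 2 * (s - 1)) (𝓝[>] 1) (𝓝 c) := by
    refine tendsto_of_tendsto_of_tendsto_of_le_of_le' (hlower.comp hNtop) (hlim.comp hNtop) ?_ ?_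
    · filter_upwards [self_mem_nhdsWithin] with s hs
      have hle := (hset s hs).2
      simp only [Function.comp_apply]
      gcongr
    · filter_upwards [self_mem_nhdsWithin, hNtop.eventually_ge_atTop 1] with s hs h1
      have hmem : N s ∈ Set.Icc 1 (N s) := ⟨h1, le_rfl⟩
      rw [← (hset s hs).1] at hmem
      have hle := hmem.2.le
      simp only [Function.comp_apply]
      gcongr
  refine hsq.sqrt.congr fun s => ?_
  rw [Real.sqrt_mul (sq_nonneg _), Real.sqrt_sq (Nat.cast_nonneg _), mul_comm]
end
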